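/- arXiv:math/0501493 — 3 statements merged into one kernel-verified Lean document; each statement's English description precedes it below -/
import Mathlib

section
/- Let n ≥ 2, let S^{n-1} denote the unit sphere in ℝ^n with its surface measure ω, and let f : [-1,1] → ℝ be a continuous function. Then the following are equivalent: (i) ∑_{i,j=1}^N f(⟨x_i,x_j⟩) ≥ 0 for every finite sequence x_1, x_2, …, x_N of unit vectors in ℝ^n; (ii) ∫∫_{S^{n-1}×S^{n-1}} f(⟨x,y⟩) h(x) h(y) dω(x) dω(y) ≥ 0 for every continuous nonnegative function h : S^{n-1} → ℝ_{≥0}. -/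
open scoped RealInnerProductSpace BigOperators MeasureTheory
open MeasureTheory

section SphereChart

open Module Metric Topology

variable {E : Type*} [NormedAddCommGroup E] [InnerProductSpace ℝ E]

/-- The graph parametrization of the unit hemisphere around `x` by the orthogonal complement
of `x`. -/
noncomputable def hemisphereParam (x : E) (w : (ℝ ∙ x)ᗮ) : E :=
  (w : E) + √(1 - ‖w‖ ^ 2) • x

lemma continuous_hemisphereParam (x : E) : Continuous (hemisphereParam x) := by
  unfold hemisphereParam
  fun_prop

lemma norm_hemisphereParam {x : E} (hx : ‖x‖ = 1) {w : (ℝ ∙ x)ᗮ} (hw : ‖w‖ ≤ 1) :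
    ‖hemisphereParam x w‖ = 1 := by
  have horth : ⟪(w : E), √(1 - ‖w‖ ^ 2) • x⟫ = 0 := by
    rw [inner_smul_right, Submodule.mem_orthogonal_singleton_iff_inner_left.1 w.2, mul_zero]
  have h := norm_add_sq_eq_norm_sq_add_norm_sq_real horth
  have hnn : 0 ≤ 1 - ‖w‖ ^ 2 := by nlinarith [norm_nonneg w]
  have hs := Real.mul_self_sqrt hnn
  rw [norm_smul, hx, Real.norm_of_nonneg (Real.sqrt_nonneg _), Submodule.norm_coe] at h
  have h1 : ‖hemisphereParam x w‖ * ‖hemisphereParam x w‖ = 1 := by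
    unfold hemisphereParam
    linarith
  nlinarith [norm_nonneg (hemisphereParam x w)]

lemma orthogonalProjectionOnto_hemisphereParam (x : E) (w : (ℝ ∙ x)ᗮ) :
    (ℝ ∙ x)ᗮ.orthogonalProjectionOnto (hemisphereParam x w) = w := by
  unfold hemisphereParam
  rw [map_add, map_smul, Submodule.orthogonalProjectionOnto_mem_subspace_eq_self,
    Submodule.orthogonalProjectionOnto_orthogonalComplement_singleton_eq_zero, smul_zero,
    add_zero]

lemma hemisphereParam_orthogonalProjectionOnto {x y : E} (hx : ‖x‖ = 1) (hy : ‖y‖ = 1)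
    (hxy : 0 ≤ ⟪x, y⟫) :
    hemisphereParam x ((ℝ ∙ x)ᗮ.orthogonalProjectionOnto y) = y := by
  have h1 := Submodule.starProjection_add_starProjection_orthogonal (K := ℝ ∙ x) y
  have h2 := Submodule.norm_sq_eq_add_norm_sq_starProjection y (ℝ ∙ x)
  rw [Submodule.starProjection_unit_singleton ℝ hx] at h1 h2
  rw [Submodule.starProjection_apply] at h1 h2
  rw [norm_smul, hx, hy, mul_one, Real.norm_of_nonneg hxy, Submodule.norm_coe] at h2
  unfold hemisphereParam
  have h3 : 1 - ‖(ℝ ∙ x)ᗮ.orthogonalProjectionOnto y‖ ^ 2 = ⟪x, y⟫ ^ 2 := by linarith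
  rw [h3, Real.sqrt_sq hxy, add_comm, h1]

lemma contDiffOn_hemisphereParam (x : E) :
    ContDiffOn ℝ 1 (hemisphereParam x) (closedBall 0 (1 / 2)) := by
  unfold hemisphereParam
  have hval : ContDiff ℝ 1 (fun w : (ℝ ∙ x)ᗮ => (w : E)) := ((ℝ ∙ x)ᗮ.subtypeL).contDiff
  refine hval.contDiffOn.add (ContDiffOn.smul (ContDiffOn.sqrt ?_ ?_) contDiffOn_const)
  · exact (contDiff_const.sub (contDiff_norm_sq ℝ)).contDiffOn
  · intro w hw
    rw [mem_closedBall_zero_iff] at hw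
    nlinarith [norm_nonneg w]

variable [FiniteDimensional ℝ E] [MeasurableSpace E] [BorelSpace E]

lemma hausdorffMeasure_sphere_lt_top {k : ℕ} (hk : finrank ℝ E = k + 1) :
    μH[(k : ℝ)] (sphere (0 : E) 1) < ⊤ := by
  have : Fact (finrank ℝ E = k + 1) := ⟨hk⟩
  refine (isCompact_sphere (0 : E) 1).measure_lt_top_of_nhdsWithin fun x hx => ?_
  rw [mem_sphere_zero_iff_norm] at hx
  have hx0 : x ≠ 0 := by rintro rfl; simp at hx
  have hF : finrank ℝ (ℝ ∙ x)ᗮ = k := Submodule.finrank_orthogonal_span_singleton hx0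
  obtain ⟨C, hC⟩ := (contDiffOn_hemisphereParam x).exists_lipschitzOnWith one_ne_zero
    (convex_closedBall _ _) (isCompact_closedBall _ _)
  refine ⟨hemisphereParam x '' closedBall 0 (1 / 2), ?_, ?_⟩
  · have hopen : IsOpen {y : E | 0 < ⟪x, y⟫ ∧
        ‖(ℝ ∙ x)ᗮ.orthogonalProjectionOnto y‖ < 1 / 2} :=
      IsOpen.and (isOpen_lt (by fun_prop) (by fun_prop)) (isOpen_lt (by fun_prop) (by fun_prop))
    have hmem : x ∈ {y : E | 0 < ⟪x, y⟫ ∧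
        ‖(ℝ ∙ x)ᗮ.orthogonalProjectionOnto y‖ < 1 / 2} := by
      refine ⟨?_, ?_⟩
      · rw [real_inner_self_eq_norm_sq, hx]; norm_num
      · rw [Submodule.orthogonalProjectionOnto_orthogonalComplement_singleton_eq_zero]
        norm_num
    filter_upwards [mem_nhdsWithin_of_mem_nhds (hopen.mem_nhds hmem), self_mem_nhdsWithin]
      with y hy hyS
    exact ⟨_, mem_closedBall_zero_iff.2 hy.2.le, hemisphereParam_orthogonalProjectionOnto hx
      (mem_sphere_zero_iff_norm.1 hyS) hy.1.le⟩
  · refine (hC.hausdorffMeasure_image_le k.cast_nonneg).trans_lt (ENNReal.mul_lt_top ?_ ?_)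
    · exact ENNReal.rpow_lt_top_of_nonneg k.cast_nonneg ENNReal.coe_ne_top
    · rw [← hF]
      exact (isCompact_closedBall _ _).measure_lt_top

lemma hausdorffMeasure_inter_sphere_pos {k : ℕ} (hk : finrank ℝ E = k + 1) {V : Set E}
    (hV : IsOpen V) (hne : (V ∩ sphere (0 : E) 1).Nonempty) :
    0 < μH[(k : ℝ)] (V ∩ sphere (0 : E) 1) := by
  have : Fact (finrank ℝ E = k + 1) := ⟨hk⟩
  obtain ⟨x, hxV, hx⟩ := hne
  rw [mem_sphere_zero_iff_norm] at hx
  have hx0 : x ≠ 0 := by rintro rfl; simp at hx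
  have hF : finrank ℝ (ℝ ∙ x)ᗮ = k := Submodule.finrank_orthogonal_span_singleton hx0
  have hO : IsOpen (ball 0 1 ∩ hemisphereParam x ⁻¹' V) :=
    isOpen_ball.inter (hV.preimage (continuous_hemisphereParam x))
  have hpos : 0 < μH[(k : ℝ)] (ball 0 1 ∩ hemisphereParam x ⁻¹' V) := by
    rw [← hF]
    exact hO.measure_pos _ ⟨0, by simp, by simpa [hemisphereParam] using hxV⟩
  have hsub : ball 0 1 ∩ hemisphereParam x ⁻¹' V ⊆
      (ℝ ∙ x)ᗮ.orthogonalProjectionOnto '' (V ∩ sphere (0 : E) 1) := by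
    rintro w ⟨hw, hwV⟩
    rw [mem_ball_zero_iff] at hw
    exact ⟨_, ⟨hwV, mem_sphere_zero_iff_norm.2 (norm_hemisphereParam hx hw.le)⟩,
      orthogonalProjectionOnto_hemisphereParam x w⟩
  have hle := (Submodule.lipschitzWith_orthogonalProjectionOnto
    (ℝ ∙ x)ᗮ).hausdorffMeasure_image_le (Nat.cast_nonneg (α := ℝ) k) (V ∩ sphere (0 : E) 1)
  rw [ENNReal.coe_one, ENNReal.one_rpow, one_mul] at hle
  exact hpos.trans_le ((measure_mono hsub).trans hle)

end SphereChart

section CompactKernel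

open Finset

variable {S : Type*} [MetricSpace S] [CompactSpace S] [MeasurableSpace S] [BorelSpace S]

lemma Continuous.integrable_of_compactSpace {X : Type*} [TopologicalSpace X] [CompactSpace X]
    [MeasurableSpace X] [OpensMeasurableSpace X] {μ : Measure X} [IsFiniteMeasure μ]
    {g : X → ℝ} (hg : Continuous g) : Integrable g μ :=
  hg.integrable_of_hasCompactSupport (HasCompactSupport.of_compactSpace g)

lemma integral_kernel_pi (P : Measure S) [IsProbabilityMeasure P] {K : S × S → ℝ}
    (hK : Continuous K) {N : ℕ} {i j : Fin N} (hij : i ≠ j) :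
    ∫ x, K (x i, x j) ∂(Measure.pi fun _ : Fin N => P) = ∫ z, K z ∂(P.prod P) := by
  have hind : ProbabilityTheory.iIndepFun (fun (i : Fin N) (x : Fin N → S) => x i)
      (Measure.pi fun _ : Fin N => P) :=
    ProbabilityTheory.iIndepFun_pi (X := fun _ => id) fun _ => aemeasurable_id
  have hmap := (hind.indepFun hij).map_prod_eq_prod_map_map
    (measurable_pi_apply i).aemeasurable (measurable_pi_apply j).aemeasurable
  have hev (i : Fin N) : (Measure.pi fun _ : Fin N => P).map (fun x => x i) = P :=
    (measurePreserving_eval (fun _ : Fin N => P) i).map_eq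
  rw [hev, hev] at hmap
  rw [← hmap, integral_map (by fun_prop) hK.aestronglyMeasurable]

lemma integral_kernel_nonneg_of_sum_nonneg (P : Measure S) [IsProbabilityMeasure P]
    {K : S × S → ℝ} (hK : Continuous K)
    (hsum : ∀ (N : ℕ) (x : Fin N → S), 0 ≤ ∑ i, ∑ j, K (x i, x j)) :
    0 ≤ ∫ z, K z ∂(P.prod P) := by
  set I := ∫ z, K z ∂(P.prod P)
  set D := ∫ x, K (x, x) ∂P
  have key (N : ℕ) : 0 ≤ (N : ℝ) * D + ((N : ℝ) ^ 2 - N) * I := by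
    have h0 : 0 ≤ ∫ x, ∑ i, ∑ j, K (x i, x j) ∂(Measure.pi fun _ : Fin N => P) :=
      integral_nonneg fun x => hsum N x
    have hInt (i j : Fin N) :
        Integrable (fun x => K (x i, x j)) (Measure.pi fun _ : Fin N => P) :=
      Continuous.integrable_of_compactSpace (by fun_prop)
    rw [integral_finsetSum _ fun i _ => integrable_finsetSum _ fun j _ => hInt i j] at h0
    simp_rw [integral_finsetSum _ fun j _ => hInt _ j] at h0
    have hval (i j : Fin N) : ∫ x, K (x i, x j) ∂(Measure.pi fun _ : Fin N => P) =
        I + if i = j then D - I else 0 := by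
      split_ifs with hij
      · subst hij
        have := (measurePreserving_eval (fun _ : Fin N => P) i).map_eq
        have hd : D = ∫ x, K (x i, x i) ∂(Measure.pi fun _ : Fin N => P) := by
          conv_lhs => rw [show D = ∫ x, K (x, x) ∂P from rfl, ← this]
          exact integral_map (measurable_pi_apply i).aemeasurable
            (by fun_prop : Continuous fun x => K (x, x)).aestronglyMeasurable
        linarith
      · rw [integral_kernel_pi P hK hij, add_zero]
    simp only [hval, sum_add_distrib, sum_const, card_univ, Fintype.card_fin, nsmul_eq_mul,
      sum_ite_eq, mem_univ, if_true] at h0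
    linarith
  by_contra! hI
  obtain ⟨N, hN⟩ := exists_nat_gt (max 0 (D / (-I) + 1))
  have hN0 : (0 : ℝ) < N := (le_max_left _ _).trans_lt hN
  have hN1 : D / (-I) + 1 < N := (le_max_right _ _).trans_lt hN
  have hD : D < (N - 1) * (-I) := by
    rw [← div_lt_iff₀ (by linarith)]
    linarith
  nlinarith [key N]

lemma integral_integral_nonneg_of_sum_nonneg (m : Measure S) [IsFiniteMeasure m]
    {K : S × S → ℝ} (hK : Continuous K)
    (hsum : ∀ (N : ℕ) (x : Fin N → S), 0 ≤ ∑ i, ∑ j, K (x i, x j))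
    {h : S → ℝ} (hh : Continuous h) (h0 : ∀ x, 0 ≤ h x) :
    0 ≤ ∫ x, ∫ y, K (x, y) * h x * h y ∂m ∂m := by
  have hd : Measurable fun x => ENNReal.ofReal (h x) := hh.measurable.ennreal_ofReal
  set Q := m.withDensity fun x => ENNReal.ofReal (h x) with hQ
  have hconv (g : S → ℝ) : ∫ x, g x ∂Q = ∫ x, h x * g x ∂m := by
    rw [hQ, integral_withDensity_eq_integral_toReal_smul hd (by simp)]
    simp only [ENNReal.toReal_ofReal (h0 _), smul_eq_mul]
  have heq : ∫ x, ∫ y, K (x, y) * h x * h y ∂m ∂m = ∫ x, ∫ y, K (x, y) ∂Q ∂Q := by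
    simp_rw [hconv, ← integral_const_mul]
    congr! 4
    ring
  have : IsFiniteMeasure Q :=
    isFiniteMeasure_withDensity_ofReal hh.integrable_of_compactSpace.2
  rw [heq]
  rcases eq_or_ne Q 0 with hQ0 | hQ0
  · simp [hQ0]
  have : NeZero Q := ⟨hQ0⟩
  have hP := integral_kernel_nonneg_of_sum_nonneg ((Q Set.univ)⁻¹ • Q) hK hsum
  rw [integral_prod _ hK.integrable_of_compactSpace] at hP
  simp only [integral_smul_measure, smul_eq_mul, integral_const_mul] at hP
  have hc : 0 < ((Q Set.univ)⁻¹).toReal :=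
    ENNReal.toReal_pos (ENNReal.inv_ne_zero.2 (measure_ne_top _ _))
      (ENNReal.inv_ne_top.2 (NeZero.ne _))
  exact nonneg_of_mul_nonneg_right (nonneg_of_mul_nonneg_right hP hc) hc

lemma sum_nonneg_of_integral_integral_nonneg (m : Measure S) [IsFiniteMeasure m]
    [m.IsOpenPosMeasure] {K : S × S → ℝ} (hK : Continuous K)
    (hInt : ∀ h : S → ℝ, Continuous h → (∀ x, 0 ≤ h x) →
      0 ≤ ∫ x, ∫ y, K (x, y) * h x * h y ∂m ∂m)
    (N : ℕ) (x : Fin N → S) : 0 ≤ ∑ i, ∑ j, K (x i, x j) := by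
  suffices H : ∀ ε > 0, 0 ≤ ∑ i, ∑ j, (K (x i, x j) + ε) by
    have hlim : Filter.Tendsto (fun ε : ℝ => ∑ i, ∑ j, (K (x i, x j) + ε))
        (nhdsWithin 0 (Set.Ioi 0)) (nhds (∑ i, ∑ j, (K (x i, x j) + 0))) :=
      ((by fun_prop : Continuous fun ε : ℝ => ∑ i, ∑ j, (K (x i, x j) + ε)).tendsto
        0).mono_left nhdsWithin_le_nhds
    simp only [add_zero] at hlim
    exact ge_of_tendsto hlim (by filter_upwards [self_mem_nhdsWithin] with ε hε using H ε hε)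
  intro ε hε
  obtain ⟨δ, hδ, hKδ⟩ :=
    Metric.uniformContinuous_iff.1 (CompactSpace.uniformContinuous_of_continuous hK) ε hε
  let φ (i : Fin N) (y : S) : ℝ := max 0 (δ - dist y (x i))
  have hφc (i) : Continuous (φ i) := by fun_prop
  have hφ0 (i y) : 0 ≤ φ i y := le_max_left _ _
  have hφpos (i) : 0 < ∫ y, φ i y ∂m := by
    refine (hφc i).integral_pos_of_hasCompactSupport_nonneg_nonzero
      (HasCompactSupport.of_compactSpace _) (hφ0 i) (x := x i) ?_
    simp [φ, hδ.ne', hδ.le]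
  let ψ (i : Fin N) (y : S) : ℝ := φ i y / ∫ y, φ i y ∂m
  have hψc (i) : Continuous (ψ i) := (hφc i).div_const _
  have hψ0 (i y) : 0 ≤ ψ i y := div_nonneg (hφ0 i y) (hφpos i).le
  have hψ1 (i) : ∫ y, ψ i y ∂m = 1 := by
    rw [integral_div, div_self (hφpos i).ne']
  have hψδ (i y) (hy : δ ≤ dist y (x i)) : ψ i y = 0 := by
    simp [ψ, φ, hy]
  have hI := hInt (fun y => ∑ i, ψ i y) (by fun_prop) fun y => sum_nonneg fun i _ => hψ0 i y
  rw [← integral_prod (fun z : S × S => K z * (∑ i, ψ i z.1) * ∑ i, ψ i z.2)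
    (Continuous.integrable_of_compactSpace (by fun_prop))] at hI
  have hexp (z : S × S) : K z * (∑ i, ψ i z.1) * ∑ i, ψ i z.2 =
      ∑ i, ∑ j, K z * (ψ i z.1 * ψ j z.2) := by
    rw [mul_assoc, sum_mul_sum, mul_sum]
    simp_rw [mul_sum]
  have hKψ (i j : Fin N) :
      Integrable (fun z : S × S => K z * (ψ i z.1 * ψ j z.2)) (m.prod m) :=
    Continuous.integrable_of_compactSpace (by fun_prop)
  simp_rw [hexp] at hI
  rw [integral_finsetSum _ fun i _ => integrable_finsetSum _ fun j _ => hKψ i j] at hI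
  simp_rw [integral_finsetSum _ fun j _ => hKψ _ j] at hI
  refine hI.trans (sum_le_sum fun i _ => sum_le_sum fun j _ => ?_)
  calc ∫ z, K z * (ψ i z.1 * ψ j z.2) ∂(m.prod m)
      ≤ ∫ z, (K (x i, x j) + ε) * (ψ i z.1 * ψ j z.2) ∂(m.prod m) := by
        refine integral_mono (hKψ i j)
          (Continuous.integrable_of_compactSpace (by fun_prop)) fun z => ?_
        rcases le_or_gt δ (dist z.1 (x i)) with h1 | h1
        · simp [hψδ i _ h1]
        rcases le_or_gt δ (dist z.2 (x j)) with h2 | h2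
        · simp [hψδ j _ h2]
        refine mul_le_mul_of_nonneg_right ?_ (mul_nonneg (hψ0 _ _) (hψ0 _ _))
        have hd : dist z (x i, x j) < δ := by
          rw [Prod.dist_eq]
          exact max_lt h1 h2
        have := (abs_lt.1 (Real.dist_eq _ _ ▸ hKδ hd)).2
        linarith
    _ = K (x i, x j) + ε := by
        rw [integral_const_mul, integral_prod_mul, hψ1, hψ1, mul_one, mul_one]

end CompactKernel

/-- Lemma 4: for a continuous `f : [-1,1] → ℝ`, nonnegativity of all code sums is
equivalent to nonnegativity of the double integral against every continuous
nonnegative density `h` on the sphere `S^{n-1}`, where the sphere carries the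
`(n-1)`-dimensional Hausdorff (surface) measure. -/
theorem code_sum_nonneg_iff_integral_nonneg (n : ℕ) (hn : 2 ≤ n) (f : ℝ → ℝ)
    (hf : ContinuousOn f (Set.Icc (-1 : ℝ) 1)) :
    (∀ (N : ℕ) (x : Fin N → EuclideanSpace ℝ (Fin n)), (∀ i, ‖x i‖ = 1) →
        0 ≤ ∑ i, ∑ j, f ⟪x i, x j⟫) ↔
      (∀ h : EuclideanSpace ℝ (Fin n) → ℝ,
        ContinuousOn h (Metric.sphere (0 : EuclideanSpace ℝ (Fin n)) 1) →
        (∀ x ∈ Metric.sphere (0 : EuclideanSpace ℝ (Fin n)) 1, 0 ≤ h x) →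
        0 ≤ ∫ x in Metric.sphere (0 : EuclideanSpace ℝ (Fin n)) 1,
              (∫ y in Metric.sphere (0 : EuclideanSpace ℝ (Fin n)) 1,
                f ⟪x, y⟫ * h x * h y ∂(μH[(n : ℝ) - 1]))
            ∂(μH[(n : ℝ) - 1])) := by
  obtain ⟨k, rfl⟩ : ∃ k, n = k + 1 := ⟨n - 1, by omega⟩
  rw [show ((k + 1 : ℕ) : ℝ) - 1 = k by push_cast; ring]
  have hfin : Module.finrank ℝ (EuclideanSpace ℝ (Fin (k + 1))) = k + 1 :=
    finrank_euclideanSpace_fin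
  set S : Set (EuclideanSpace ℝ (Fin (k + 1))) := Metric.sphere 0 1
  have hS : MeasurableSet S := Metric.isClosed_sphere.measurableSet
  have : CompactSpace S := isCompact_iff_compactSpace.1 (isCompact_sphere _ _)
  let m : Measure S := Measure.comap Subtype.val μH[(k : ℝ)]
  have hm (s : Set S) : m s = μH[(k : ℝ)] (Subtype.val '' s) :=
    (MeasurableEmbedding.subtype_coe hS).comap_apply _ s
  have : IsFiniteMeasure m := ⟨by
    rw [hm, Set.image_univ, Subtype.range_coe]
    exact hausdorffMeasure_sphere_lt_top hfin⟩
  have : m.IsOpenPosMeasure := ⟨by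
    rintro U hU ⟨u, hu⟩
    obtain ⟨V, hV, rfl⟩ := isOpen_induced_iff.1 hU
    rw [hm, Subtype.image_preimage_coe, Set.inter_comm]
    exact (hausdorffMeasure_inter_sphere_pos hfin hV ⟨u, hu, u.2⟩).ne'⟩
  have hnorm (x : S) : ‖(x : EuclideanSpace ℝ (Fin (k + 1)))‖ = 1 :=
    mem_sphere_zero_iff_norm.1 x.2
  let K (z : S × S) : ℝ :=
    f ⟪(z.1 : EuclideanSpace ℝ (Fin (k + 1))), (z.2 : EuclideanSpace ℝ (Fin (k + 1)))⟫
  have hK : Continuous K := by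
    refine hf.comp_continuous (by fun_prop) fun z => abs_le.1 ?_
    simpa [hnorm] using abs_real_inner_le_norm (z.1 : EuclideanSpace ℝ (Fin (k + 1))) z.2
  have hconv (h : EuclideanSpace ℝ (Fin (k + 1)) → ℝ) :
      ∫ x in S, (∫ y in S, f ⟪x, y⟫ * h x * h y ∂μH[(k : ℝ)]) ∂μH[(k : ℝ)] =
        ∫ x : S, ∫ y : S, K (x, y) * h x * h y ∂m ∂m := by
    rw [← integral_subtype_comap hS]
    simp_rw [← integral_subtype_comap hS]
    rfl
  constructor
  · intro hsum h hh h0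
    rw [hconv]
    exact integral_integral_nonneg_of_sum_nonneg m hK
      (fun N x => hsum N (fun i => x i) fun i => hnorm (x i))
      (h := fun x : S => h x) hh.domRestrict fun x => h0 x x.2
  · intro hInt N x hx
    refine sum_nonneg_of_integral_integral_nonneg m hK (fun h hh h0 => ?_) N
      fun i => ⟨x i, mem_sphere_zero_iff_norm.2 (hx i)⟩
    have hext (y : S) : Function.extend Subtype.val h 0 (y : EuclideanSpace ℝ (Fin (k + 1))) =
        h y := Subtype.val_injective.extend_apply h 0 y
    have hI := hInt (Function.extend Subtype.val h 0)
      (continuousOn_iff_continuous_domRestrict.2 (hh.congr fun y => (hext y).symm))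
      fun y hy => (h0 ⟨y, hy⟩).trans_eq (hext ⟨y, hy⟩).symm
    rw [hconv] at hI
    simpa only [hext] using hI
end

section
/- The kissing number in dimension 10 is at most 594: every finite set of unit vectors x_1, …, x_N in ℝ^{10} satisfying ⟨x_i, x_j⟩ ≤ 1/2 for all i ≠ j has N ≤ 594. -/
open scoped RealInnerProductSpace BigOperators

namespace KissingBound

section Zonal

open MvPolynomial

variable {σ : Type*}

lemma pderiv_comm (i j : σ) (p : MvPolynomial σ ℝ) :
    pderiv i (pderiv j p) = pderiv j (pderiv i p) := by
  ext m
  simp only [coeff_pderiv, Finsupp.add_apply, add_right_comm m (Finsupp.single i 1)]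
  by_cases h : i = j
  · subst h; rfl
  · simp [Finsupp.single_eq_of_ne h, Finsupp.single_eq_of_ne (Ne.symm h)]
    ring

variable [Fintype σ]

/-- The Fischer (apolar) pairing: monomials are orthogonal and `X ^ m` has square norm `m!`. -/
noncomputable def fischer : MvPolynomial σ ℝ →ₗ[ℝ] MvPolynomial σ ℝ →ₗ[ℝ] ℝ :=
  (basisMonomials σ ℝ).constr ℝ fun m => ((∏ i, (m i).factorial : ℕ) : ℝ) • lcoeff ℝ m

lemma fischer_monomial (m : σ →₀ ℕ) (a : ℝ) (q : MvPolynomial σ ℝ) :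
    fischer (monomial m a) q = a * (((∏ i, (m i).factorial : ℕ) : ℝ) * coeff m q) := by
  have h : monomial m a = a • basisMonomials σ ℝ m := by
    simp [smul_monomial]
  rw [h, map_smul, fischer, Module.Basis.constr_basis]
  simp [lcoeff]

lemma fischer_self_nonneg (p : MvPolynomial σ ℝ) : 0 ≤ fischer p p := by
  have h : fischer p p = ∑ m ∈ p.support,
      coeff m p * (((∏ i, (m i).factorial : ℕ) : ℝ) * coeff m p) := by
    conv_lhs => enter [1, 2]; rw [← support_sum_monomial_coeff p]
    rw [map_sum, LinearMap.sum_apply]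
    exact Finset.sum_congr rfl fun m _ => fischer_monomial m _ p
  rw [h]
  refine Finset.sum_nonneg fun m _ => ?_
  rw [mul_left_comm]
  exact mul_nonneg (Nat.cast_nonneg _) (mul_self_nonneg _)

lemma fischer_X_mul (i : σ) (p q : MvPolynomial σ ℝ) :
    fischer (X i * p) q = fischer p (pderiv i q) := by
  classical
  induction p using MvPolynomial.induction_on' with
  | add p₁ p₂ h₁ h₂ => simp [mul_add, h₁, h₂]
  | monomial m a =>
    have hX : X i * monomial m a = monomial (m + Finsupp.single i 1) a := by
      rw [X, monomial_mul, one_mul, add_comm]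
    have hfac : ∏ j, ((m + Finsupp.single i 1 : σ →₀ ℕ) j).factorial
        = (m i + 1) * ∏ j, (m j).factorial := by
      rw [← Finset.mul_prod_erase Finset.univ _ (Finset.mem_univ i),
        ← Finset.mul_prod_erase Finset.univ (fun j => (m j).factorial) (Finset.mem_univ i),
        ← mul_assoc, ← Nat.factorial_succ]
      congr 1
      · simp
      · refine Finset.prod_congr rfl fun j hj => ?_
        simp [Finsupp.single_eq_of_ne (Finset.ne_of_mem_erase hj)]
    rw [hX, fischer_monomial, fischer_monomial, coeff_pderiv, hfac]
    push_cast
    ring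

/-- The linear form `⟨x, ·⟩`. -/
noncomputable def linForm (x : σ → ℝ) : MvPolynomial σ ℝ := ∑ i, C (x i) * X i

/-- The squared Euclidean norm. -/
noncomputable def normSq : MvPolynomial σ ℝ := ∑ i, X i * X i

/-- The derivative in direction `x`. -/
noncomputable def dirDeriv (x : σ → ℝ) :
    Derivation ℝ (MvPolynomial σ ℝ) (MvPolynomial σ ℝ) := ∑ i, x i • pderiv i

/-- The Laplacian. -/
noncomputable def laplacian : MvPolynomial σ ℝ →ₗ[ℝ] MvPolynomial σ ℝ :=
  ∑ i, (pderiv i).toLinearMap ∘ₗ (pderiv i).toLinearMap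

lemma dirDeriv_apply (x : σ → ℝ) (p : MvPolynomial σ ℝ) :
    dirDeriv x p = ∑ i, C (x i) * pderiv i p := by
  have h := map_sum (Derivation.coeFnAddMonoidHom (R := ℝ) (A := MvPolynomial σ ℝ)
    (M := MvPolynomial σ ℝ)) (fun i => x i • pderiv i) Finset.univ
  refine (congrFun h p).trans ?_
  simp [Finset.sum_apply, smul_eq_C_mul]

lemma laplacian_apply (p : MvPolynomial σ ℝ) :
    laplacian p = ∑ i, pderiv i (pderiv i p) := by
  simp [laplacian]

lemma pderiv_linForm (x : σ → ℝ) (i : σ) : pderiv i (linForm x) = C (x i) := by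
  classical
  simp [linForm, pderiv_X, Pi.single_apply]

lemma pderiv_normSq (i : σ) : pderiv i (normSq : MvPolynomial σ ℝ) = 2 * X i := by
  classical
  simp [normSq, pderiv_X, Pi.single_apply, Finset.sum_add_distrib, two_mul]

lemma dirDeriv_linForm {x : σ → ℝ} (hx : ∑ i, x i * x i = 1) : dirDeriv x (linForm x) = 1 := by
  simp only [dirDeriv_apply, pderiv_linForm, ← C_mul, ← map_sum, hx, C_1]

lemma dirDeriv_normSq (x : σ → ℝ) : dirDeriv x normSq = 2 * linForm x := by
  simp only [dirDeriv_apply, pderiv_normSq, linForm, Finset.mul_sum]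
  exact Finset.sum_congr rfl fun i _ => by ring

lemma laplacian_linForm_mul (x : σ → ℝ) (p : MvPolynomial σ ℝ) :
    laplacian (linForm x * p) = 2 * dirDeriv x p + linForm x * laplacian p := by
  simp only [laplacian_apply, dirDeriv_apply, pderiv_mul, pderiv_linForm, map_add, pderiv_C,
    Finset.mul_sum, ← Finset.sum_add_distrib]
  exact Finset.sum_congr rfl fun i _ => by ring

lemma laplacian_normSq_mul {k : ℕ} {p : MvPolynomial σ ℝ} (hp : p.IsHomogeneous k) :
    laplacian (normSq * p)
      = C (2 * (Fintype.card σ : ℝ) + 4 * k) * p + normSq * laplacian p := by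
  have euler : ∑ i, X i * pderiv i p = C (k : ℝ) * p := by
    rw [hp.sum_X_mul_pderiv, nsmul_eq_mul, map_natCast]
  have h : ∀ i : σ, pderiv i (pderiv i (normSq * p))
      = 2 * p + 4 * (X i * pderiv i p) + normSq * pderiv i (pderiv i p) := fun i => by
    have h2 : pderiv i (2 : MvPolynomial σ ℝ) = 0 := by
      rw [← map_ofNat (C (σ := σ) (R := ℝ)) 2, pderiv_C]
    simp only [pderiv_mul, pderiv_normSq, map_add, pderiv_X_self, h2]
    ring
  simp only [laplacian_apply, h, Finset.sum_add_distrib, ← Finset.mul_sum, euler]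
  simp only [Finset.sum_const, Finset.card_univ, nsmul_eq_mul, map_add, map_mul, map_natCast,
    map_ofNat]
  ring

lemma laplacian_dirDeriv (x : σ → ℝ) (p : MvPolynomial σ ℝ) :
    laplacian (dirDeriv x p) = dirDeriv x (laplacian p) := by
  simp only [laplacian_apply, dirDeriv_apply, map_sum, pderiv_C_mul]
  rw [Finset.sum_comm]
  refine Finset.sum_congr rfl fun i _ => Finset.sum_congr rfl fun j _ => ?_
  rw [pderiv_comm i j p, pderiv_comm i j]

lemma fischer_linForm_mul (x : σ → ℝ) (p q : MvPolynomial σ ℝ) :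
    fischer (linForm x * p) q = fischer p (dirDeriv x q) := by
  simp only [linForm, Finset.sum_mul, map_sum, LinearMap.sum_apply, dirDeriv_apply, C_mul',
    smul_mul_assoc, map_smul, LinearMap.smul_apply, fischer_X_mul]

lemma fischer_normSq_mul (p q : MvPolynomial σ ℝ) :
    fischer (normSq * p) q = fischer p (laplacian q) := by
  simp only [normSq, Finset.sum_mul, map_sum, LinearMap.sum_apply, laplacian_apply, mul_assoc,
    fischer_X_mul]

lemma isHomogeneous_linForm (x : σ → ℝ) : (linForm x).IsHomogeneous 1 :=
  IsHomogeneous.sum _ _ _ fun i _ => isHomogeneous_C_mul_X (x i) i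

lemma isHomogeneous_normSq : (normSq : MvPolynomial σ ℝ).IsHomogeneous 2 :=
  IsHomogeneous.sum _ _ _ fun i _ => (isHomogeneous_X ℝ i).mul (isHomogeneous_X ℝ i)

lemma isHomogeneous_dirDeriv (x : σ → ℝ) {k : ℕ} {p : MvPolynomial σ ℝ}
    (hp : p.IsHomogeneous (k + 1)) : (dirDeriv x p).IsHomogeneous k := by
  rw [dirDeriv_apply]
  exact IsHomogeneous.sum _ _ _ fun i _ => by
    simpa using (isHomogeneous_C σ (x i)).mul (hp.pderiv (i := i))

lemma eval_dirDeriv_self (x : σ → ℝ) {k : ℕ} {p : MvPolynomial σ ℝ} (hp : p.IsHomogeneous k) :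
    eval x (dirDeriv x p) = k * eval x p := by
  have h := congrArg (eval x) hp.sum_X_mul_pderiv
  simpa [dirDeriv_apply] using h

/-- The coefficient in the three-term recurrence of the monic Gegenbauer polynomials
in dimension `n`. -/
noncomputable def recCoeff (n : ℝ) (k : ℕ) : ℝ :=
  (k + 1) * (k + n - 2) / ((2 * k + n) * (2 * k + n - 2))

/-- The factor relating the derivative of the zonal harmonic of degree `k + 1` along its pole
to the zonal harmonic of degree `k`. -/
noncomputable def derivCoeff (n : ℝ) (k : ℕ) : ℝ :=
  (k + 1) * (k + n - 2) / (2 * k + n - 2)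

/-- The monic Gegenbauer polynomial of degree `k` in dimension `n`. -/
noncomputable def gegenbauer (n : ℝ) : ℕ → ℝ → ℝ
  | 0, _ => 1
  | 1, t => t
  | k + 2, t => t * gegenbauer n (k + 1) t - recCoeff n k * gegenbauer n k t

/-- The zonal harmonic of degree `k` with pole at the unit vector `x`. -/
noncomputable def zonal (x : σ → ℝ) : ℕ → MvPolynomial σ ℝ
  | 0 => 1
  | 1 => linForm x
  | k + 2 => linForm x * zonal x (k + 1) - C (recCoeff (Fintype.card σ) k) * (normSq * zonal x k)

lemma isHomogeneous_zonal (x : σ → ℝ) : ∀ k, (zonal x k).IsHomogeneous k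
  | 0 => isHomogeneous_one σ ℝ
  | 1 => isHomogeneous_linForm x
  | k + 2 => by
    have h₁ := (isHomogeneous_linForm x).mul (isHomogeneous_zonal x (k + 1))
    have h₂ := (isHomogeneous_C σ (recCoeff (Fintype.card σ) k)).mul
      (isHomogeneous_normSq.mul (isHomogeneous_zonal x k))
    rw [show 1 + (k + 1) = k + 2 by ring] at h₁
    rw [show 0 + (2 + k) = k + 2 by ring] at h₂
    exact h₁.sub h₂

lemma eval_zonal (x y : σ → ℝ) (hy : ∑ i, y i * y i = 1) :
    ∀ k, eval y (zonal x k) = gegenbauer (Fintype.card σ) k (∑ i, x i * y i)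
  | 0 => by simp [zonal, gegenbauer]
  | 1 => by simp [zonal, gegenbauer, linForm]
  | k + 2 => by
    simp [zonal, gegenbauer, eval_zonal x y hy k, eval_zonal x y hy (k + 1), linForm, normSq, hy]

lemma derivCoeff_succ {n : ℝ} (hn : 3 ≤ n) (k : ℕ) :
    derivCoeff n (k + 1) = 1 + derivCoeff n k - 2 * recCoeff n k := by
  have hk : (0 : ℝ) ≤ k := Nat.cast_nonneg k
  obtain ⟨b, hb, rfl⟩ : ∃ b : ℝ, 0 < b ∧ n = b + 2 - 2 * k :=
    ⟨2 * k + n - 2, by linarith, by ring⟩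
  have e₀ : 2 * (k : ℝ) + (b + 2 - 2 * k) = b + 2 := by ring
  have e₁ : 2 * ((k : ℝ) + 1) + (b + 2 - 2 * k) = b + 4 := by ring
  simp only [derivCoeff, recCoeff, Nat.cast_add, Nat.cast_one, e₀, e₁, add_sub_cancel_right,
    show b + 4 - 2 = b + 2 by ring]
  field_simp
  ring

lemma recCoeff_mul_derivCoeff {n : ℝ} (hn : 3 ≤ n) (k : ℕ) :
    recCoeff n k * (derivCoeff n (k + 2) - 1) = recCoeff n (k + 1) * derivCoeff n k := by
  have hk : (0 : ℝ) ≤ k := Nat.cast_nonneg k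
  obtain ⟨b, hb, rfl⟩ : ∃ b : ℝ, 0 < b ∧ n = b + 2 - 2 * k :=
    ⟨2 * k + n - 2, by linarith, by ring⟩
  have e₀ : 2 * (k : ℝ) + (b + 2 - 2 * k) = b + 2 := by ring
  have e₁ : 2 * ((k : ℝ) + 1) + (b + 2 - 2 * k) = b + 4 := by ring
  have e₂ : 2 * ((k : ℝ) + 2) + (b + 2 - 2 * k) - 2 = b + 4 := by ring
  simp only [derivCoeff, recCoeff, Nat.cast_add, Nat.cast_one, Nat.cast_ofNat, e₀, e₁, e₂,
    add_sub_cancel_right, show b + 4 - 2 = b + 2 by ring]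
  field_simp
  ring

lemma two_mul_derivCoeff {n : ℝ} (hn : 3 ≤ n) (k : ℕ) :
    2 * derivCoeff n k = recCoeff n k * (2 * n + 4 * k) := by
  have hk : (0 : ℝ) ≤ k := Nat.cast_nonneg k
  have h₀ : 2 * (k : ℝ) + n ≠ 0 := by linarith
  simp only [derivCoeff, recCoeff]
  field_simp
  ring

lemma dirDeriv_C_mul (x : σ → ℝ) (a : ℝ) (p : MvPolynomial σ ℝ) :
    dirDeriv x (C a * p) = C a * dirDeriv x p := by
  rw [C_mul', Derivation.map_smul, C_mul']

lemma dirDeriv_zonal_succ {x : σ → ℝ} (hx : ∑ i, x i * x i = 1) (hσ : 3 ≤ Fintype.card σ) :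
    ∀ k : ℕ, dirDeriv x (zonal x (k + 1)) = C (derivCoeff (Fintype.card σ) k) * zonal x k
  | 0 => by
    have hn : (3 : ℝ) ≤ Fintype.card σ := by exact_mod_cast hσ
    have h0 : (Fintype.card σ : ℝ) - 2 ≠ 0 := by linarith
    simp [zonal, derivCoeff, dirDeriv_linForm hx, h0]
  | 1 => by
    have hn : (3 : ℝ) ≤ Fintype.card σ := by exact_mod_cast hσ
    have h0 : (Fintype.card σ : ℝ) - 2 ≠ 0 := by linarith
    have h1 := congrArg (C (σ := σ)) (derivCoeff_succ hn 0)
    have h2 : derivCoeff (Fintype.card σ) 0 = 1 := by simp [derivCoeff, h0]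
    simp only [h2, map_sub, map_add, map_mul, map_ofNat, map_one] at h1
    have hz : zonal x 2 = linForm x * linForm x
      - C (recCoeff (Fintype.card σ) 0) * (normSq * 1) := rfl
    rw [hz, map_sub, dirDeriv_C_mul, Derivation.leibniz, mul_one, dirDeriv_linForm hx,
      dirDeriv_normSq]
    simp only [smul_eq_mul, zonal]
    linear_combination -linForm x * h1
  | k + 2 => by
    have hn : (3 : ℝ) ≤ Fintype.card σ := by exact_mod_cast hσ
    have hA := congrArg (C (σ := σ)) (derivCoeff_succ hn (k + 1))
    have hB := congrArg (C (σ := σ)) (recCoeff_mul_derivCoeff hn k)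
    have ih := dirDeriv_zonal_succ hx hσ (k + 1)
    simp only [map_sub, map_add, map_mul, map_ofNat, map_one] at hA hB
    have hz : zonal x (k + 3) = linForm x * zonal x (k + 2)
      - C (recCoeff (Fintype.card σ) (k + 1)) * (normSq * zonal x (k + 1)) := rfl
    have hz' : zonal x (k + 2) = linForm x * zonal x (k + 1)
      - C (recCoeff (Fintype.card σ) k) * (normSq * zonal x k) := rfl
    rw [hz, map_sub, dirDeriv_C_mul, Derivation.leibniz, Derivation.leibniz, ih,
      dirDeriv_zonal_succ hx hσ k, dirDeriv_linForm hx, dirDeriv_normSq]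
    simp only [smul_eq_mul]
    linear_combination (1 - C (derivCoeff (Fintype.card σ) (k + 2))) * hz'
      - linForm x * zonal x (k + 1) * hA + normSq * zonal x k * hB

lemma laplacian_zonal {x : σ → ℝ} (hx : ∑ i, x i * x i = 1) (hσ : 3 ≤ Fintype.card σ) :
    ∀ k : ℕ, laplacian (zonal x k) = 0
  | 0 => by simp [zonal, laplacian_apply]
  | 1 => by simp [zonal, laplacian_apply, pderiv_linForm]
  | k + 2 => by
    have hn : (3 : ℝ) ≤ Fintype.card σ := by exact_mod_cast hσ
    have h := congrArg (C (σ := σ)) (two_mul_derivCoeff hn k)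
    simp only [map_mul, map_ofNat] at h
    rw [zonal, map_sub, laplacian_linForm_mul, C_mul', map_smul,
      laplacian_normSq_mul (isHomogeneous_zonal x k), laplacian_zonal hx hσ k,
      laplacian_zonal hx hσ (k + 1), dirDeriv_zonal_succ hx hσ k, ← C_mul']
    linear_combination zonal x k * h

/-- The zonal harmonic reproduces point evaluation on harmonic homogeneous polynomials. -/
lemma fischer_zonal (x : σ → ℝ) :
    ∀ (k : ℕ) {q : MvPolynomial σ ℝ}, q.IsHomogeneous k → laplacian q = 0 →
      fischer (zonal x k) q = k.factorial * eval x q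
  | 0, q, hq, _ => by
    rw [totalDegree_eq_zero_iff_eq_C.mp ((totalDegree_zero_iff_isHomogeneous (p := q)).mpr hq)]
    have h1 : zonal x 0 = monomial 0 1 := rfl
    rw [h1, fischer_monomial]
    simp
  | k + 1, q, hq, hΔ => by
    have step : fischer (zonal x (k + 1)) q = fischer (zonal x k) (dirDeriv x q) := by
      cases k with
      | zero => simpa [zonal] using fischer_linForm_mul x 1 q
      | succ k => simp [zonal, C_mul', fischer_linForm_mul, fischer_normSq_mul, hΔ]
    rw [step, fischer_zonal x k (isHomogeneous_dirDeriv x hq)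
      (by rw [laplacian_dirDeriv, hΔ, map_zero]), eval_dirDeriv_self x hq, Nat.factorial_succ]
    push_cast
    ring

/-- Gegenbauer polynomials are positive definite on the sphere. -/
theorem sum_gegenbauer_nonneg (hσ : 3 ≤ Fintype.card σ) {ι : Type*} [Fintype ι]
    (x : ι → EuclideanSpace ℝ σ) (hx : ∀ i, ‖x i‖ = 1) (k : ℕ) :
    0 ≤ ∑ i, ∑ j, gegenbauer (Fintype.card σ) k ⟪x i, x j⟫ := by
  have hx' : ∀ i, ∑ a, x i a * x i a = 1 := fun i => by
    have h := real_inner_self_eq_norm_sq (x i)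
    rw [hx i, PiLp.inner_apply] at h
    simpa [← sq] using h
  set h := ∑ i, zonal (x i) k
  have hom : h.IsHomogeneous k := IsHomogeneous.sum _ _ _ fun i _ => isHomogeneous_zonal _ k
  have harm : laplacian h = 0 := by
    rw [map_sum]
    exact Finset.sum_eq_zero fun i _ => laplacian_zonal (hx' i) hσ k
  have key : fischer h h
      = k.factorial * ∑ i, ∑ j, gegenbauer (Fintype.card σ) k ⟪x i, x j⟫ := by
    have h1 : ∀ j, eval (x j) h = ∑ i, gegenbauer (Fintype.card σ) k ⟪x i, x j⟫ := fun j => by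
      rw [map_sum]
      refine Finset.sum_congr rfl fun i _ => ?_
      rw [eval_zonal _ _ (hx' j), PiLp.inner_apply]
      simp [mul_comm]
    conv_lhs => enter [1]; rw [map_sum]
    rw [LinearMap.sum_apply, Finset.sum_comm, Finset.mul_sum]
    exact Finset.sum_congr rfl fun j _ => by rw [fischer_zonal _ k hom harm, h1]
  exact nonneg_of_mul_nonneg_right (key ▸ fischer_self_nonneg h)
    (Nat.cast_pos.mpr k.factorial_pos)

end Zonal

section Antipodal

/-- The weight of a point at inner product `t` with a reference point; it is supported on
`t < -1/√2`. -/
noncomputable def antipodalWeight (t : ℝ) : ℝ := if t < 0 then √(t ^ 2 - 1 / 2) else 0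

lemma antipodalWeight_nonneg (t : ℝ) : 0 ≤ antipodalWeight t := by
  unfold antipodalWeight
  split_ifs <;> positivity

lemma sq_antipodalWeight_ge {t : ℝ} (ht : t < 0) : t ^ 2 - 1 / 2 ≤ antipodalWeight t ^ 2 := by
  rw [antipodalWeight, if_pos ht]
  rcases le_total 0 (t ^ 2 - 1 / 2) with h | h
  · exact (Real.sq_sqrt h).ge
  · exact h.trans (sq_nonneg _)

lemma antipodalWeight_eq_zero_or (t : ℝ) :
    antipodalWeight t = 0 ∨ t < 0 ∧ antipodalWeight t ^ 2 = t ^ 2 - 1 / 2 := by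
  unfold antipodalWeight
  split_ifs with ht
  · rcases le_total 0 (t ^ 2 - 1 / 2) with h | h
    · exact Or.inr ⟨ht, Real.sq_sqrt h⟩
    · exact Or.inl (Real.sqrt_eq_zero_of_nonpos h)
  · exact Or.inl rfl

lemma antipodalWeight_mul_le {s t c : ℝ} (hc : c ≤ 1 / 2) :
    antipodalWeight s * antipodalWeight t * (c - s * t)
      ≤ -(antipodalWeight s ^ 2 * antipodalWeight t ^ 2) := by
  rcases antipodalWeight_eq_zero_or s with hs | ⟨hs, hs'⟩
  · simp [hs]
  rcases antipodalWeight_eq_zero_or t with ht | ⟨ht, ht'⟩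
  · simp [ht]
  have h₀ := mul_nonneg (antipodalWeight_nonneg s) (antipodalWeight_nonneg t)
  set a := antipodalWeight s
  set b := antipodalWeight t
  have hst : 1 / 2 ≤ s * t := by
    have h1 : 1 / 2 ≤ s ^ 2 := by nlinarith [sq_nonneg a]
    have h2 : 1 / 2 ≤ t ^ 2 := by nlinarith [sq_nonneg b]
    nlinarith [mul_pos_of_neg_of_neg hs ht]
  have hab : a * b ≤ s * t - 1 / 2 := by
    refine abs_le_of_sq_le_sq' ?_ (by linarith) |>.2
    rw [mul_pow, hs', ht']
    nlinarith [sq_nonneg (s - t)]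
  nlinarith

/-- A unit vector sees little antipodal mass of a kissing configuration. -/
lemma sum_sq_antipodalWeight_le {E : Type*} [NormedAddCommGroup E] [InnerProductSpace ℝ E]
    {ι : Type*} [Fintype ι] {u : E} (hu : ‖u‖ = 1) {x : ι → E} (hx : ∀ i, ‖x i‖ = 1)
    (hsep : ∀ i j, i ≠ j → ⟪x i, x j⟫ ≤ 1 / 2) :
    2 * ∑ i, antipodalWeight ⟪u, x i⟫ ^ 2 ≤ 1 := by
  classical
  set a : ι → ℝ := fun i => antipodalWeight ⟪u, x i⟫
  set v : E := ∑ i, a i • x i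
  have huv : ⟪u, v⟫ ^ 2 ≤ ⟪v, v⟫ := by
    have h := real_inner_mul_inner_self_le u v
    rw [real_inner_self_eq_norm_sq u, hu] at h
    nlinarith
  have h₁ : ⟪v, v⟫ - ⟪u, v⟫ ^ 2
      = ∑ i, ∑ j, a i * a j * (⟪x i, x j⟫ - ⟪u, x i⟫ * ⟪u, x j⟫) := by
    simp only [v, sum_inner, inner_sum, real_inner_smul_left, real_inner_smul_right, sq,
      Finset.sum_mul_sum, ← Finset.sum_sub_distrib]
    exact Finset.sum_congr rfl fun i _ => Finset.sum_congr rfl fun j _ => by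
      rw [real_inner_comm]
      ring
  have h₂ : ∀ i j, a i * a j * (⟪x i, x j⟫ - ⟪u, x i⟫ * ⟪u, x j⟫)
      ≤ -(a i ^ 2 * a j ^ 2) + if i = j then a i ^ 2 / 2 else 0 := fun i j => by
    split_ifs with hij
    · subst hij
      have h := antipodalWeight_mul_le (s := ⟪u, x i⟫) (t := ⟪u, x i⟫) le_rfl
      rw [real_inner_self_eq_norm_sq, hx i]
      simp only [a]
      linarith
    · rw [add_zero]
      exact antipodalWeight_mul_le (hsep i j hij)
  have h₃ : 0 ≤ -((∑ i, a i ^ 2) * ∑ i, a i ^ 2) + (∑ i, a i ^ 2) / 2 := by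
    calc 0 ≤ ⟪v, v⟫ - ⟪u, v⟫ ^ 2 := sub_nonneg.mpr huv
      _ ≤ ∑ i, ∑ j, (-(a i ^ 2 * a j ^ 2) + if i = j then a i ^ 2 / 2 else 0) := by
        rw [h₁]
        exact Finset.sum_le_sum fun i _ => Finset.sum_le_sum fun j _ => h₂ i j
      _ = _ := by
        simp [Finset.sum_add_distrib, Finset.sum_mul_sum, Finset.sum_div]
  have h₄ : 0 ≤ ∑ i, a i ^ 2 := Finset.sum_nonneg fun i _ => sq_nonneg _
  by_contra! h
  nlinarith

end Antipodal

section DimensionTen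

/-- A test function with nonnegative Gegenbauer coefficients in dimension ten. -/
noncomputable def testFun (t : ℝ) : ℝ :=
  1999 / 2000 * gegenbauer 10 0 t + 4009 / 500 * gegenbauer 10 1 t
    + 17147 / 500 * gegenbauer 10 2 t + 49813 / 500 * gegenbauer 10 3 t
    + 5353 / 25 * gegenbauer 10 4 t + 167287 / 500 * gegenbauer 10 5 t
    + 75713 / 200 * gegenbauer 10 6 t + 248773 / 1000 * gegenbauer 10 7 t
    + 303143 / 500 * gegenbauer 10 11 t

lemma testFun_eq (t : ℝ) : testFun t =
    -98653 / 6720000 + 11272003 / 69888000 * t + 376111 / 224000 * t ^ 2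
      - 958201 / 99840 * t ^ 3 - 121621 / 1200 * t ^ 4
      - 173796131 / 1040000 * t ^ 5 + 75713 / 200 * t ^ 6 + 195332471 / 182000 * t ^ 7
      - 3334573 / 2800 * t ^ 9 + 303143 / 500 * t ^ 11 := by
  simp only [testFun, gegenbauer, recCoeff]
  push_cast
  ring

lemma mul_pow_nonneg {a b t : ℝ} (ha : a ≤ t) (hb : t ≤ b) (i j : ℕ) :
    0 ≤ (t - a) ^ i * (b - t) ^ j :=
  mul_nonneg (pow_nonneg (sub_nonneg.mpr ha) i) (pow_nonneg (sub_nonneg.mpr hb) j)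

lemma testFun_nonpos_of_le {t : ℝ} (h₁ : -7071 / 10000 ≤ t) (h₂ : t ≤ -6 / 10) :
    testFun t ≤ 0 := by
  have h := mul_pow_nonneg h₁ h₂
  rw [testFun_eq]
  linarith [h 11 0, h 10 1, h 9 2, h 8 3, h 7 4, h 6 5, h 5 6, h 4 7, h 3 8, h 2 9, h 1 10, h 0 11]

/-- On subintervals `testFun` is certified through its three approximate double zeros. -/
lemma testFun_nonpos_of_mem_Icc {a b t : ℝ} (h₁ : -6 / 10 ≤ t) (h₂ : t ≤ 1 / 2)
    (ha : a ≤ t) (hb : t ≤ b)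
    (hab : (a, b) ∈ ({(-6 / 10, -3 / 10), (-3 / 10, 0), (0, 3 / 10), (3 / 10, 1 / 2)} :
      Set (ℝ × ℝ))) :
    testFun t ≤ 0 := by
  have h := mul_pow_nonneg ha hb
  have hz := fun i j => mul_nonneg (mul_nonneg (sub_nonneg.mpr h₂) (sq_nonneg
    ((t + 415 / 1000) * (t + 2133 / 10000) * (t - 813 / 10000)))) (mul_pow_nonneg h₁ h₂ i j)
  rw [testFun_eq]
  simp only [Set.mem_insert_iff, Set.mem_singleton_iff, Prod.mk.injEq] at hab
  rcases hab with ⟨rfl, rfl⟩ | ⟨rfl, rfl⟩ | ⟨rfl, rfl⟩ | ⟨rfl, rfl⟩ <;>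
  linarith [h 6 0, h 5 1, h 4 2, h 3 3, h 2 4, h 1 5, h 0 6,
    hz 4 0, hz 3 1, hz 2 2, hz 1 3, hz 0 4]

lemma testFun_nonpos_of_ge {t : ℝ} (h₁ : -6 / 10 ≤ t) (h₂ : t ≤ 1 / 2) : testFun t ≤ 0 := by
  rcases le_total t (-3 / 10) with h₃ | h₃
  · exact testFun_nonpos_of_mem_Icc h₁ h₂ h₁ h₃ (by simp)
  rcases le_total t 0 with h₄ | h₄
  · exact testFun_nonpos_of_mem_Icc h₁ h₂ h₃ h₄ (by simp)
  rcases le_total t (3 / 10) with h₅ | h₅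
  · exact testFun_nonpos_of_mem_Icc h₁ h₂ h₄ h₅ (by simp)
  · exact testFun_nonpos_of_mem_Icc h₁ h₂ h₅ h₂ (by simp)

lemma testFun_le_of_le {t : ℝ} (h₁ : -1 ≤ t) (h₂ : t ≤ -7071 / 10000) :
    testFun t ≤ 91 / 25 * (2 * (t ^ 2 - 1 / 2)) := by
  have h := mul_pow_nonneg h₁ h₂
  have hz := fun i j => mul_nonneg (sq_nonneg (t + 80668 / 100000)) (h i j)
  rw [testFun_eq]
  linarith [h 1 0, h 0 1, hz 9 0, hz 8 1, hz 7 2, hz 6 3, hz 5 4, hz 4 5, hz 3 6, hz 2 7,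
    hz 1 8, hz 0 9]

lemma testFun_le {t : ℝ} (h₁ : -1 ≤ t) (h₂ : t ≤ 1 / 2) :
    testFun t ≤ 91 / 25 * (2 * antipodalWeight t ^ 2) := by
  have hw := sq_nonneg (antipodalWeight t)
  rcases le_total t (-7071 / 10000) with h₃ | h₃
  · have h := sq_antipodalWeight_ge (t := t) (by linarith)
    linarith [testFun_le_of_le h₁ h₃]
  rcases le_total t (-6 / 10) with h₄ | h₄
  · linarith [testFun_nonpos_of_le h₃ h₄]
  · linarith [testFun_nonpos_of_ge h₄ h₂]

lemma sum_testFun_ge {ι : Type*} [Fintype ι] (x : ι → EuclideanSpace ℝ (Fin 10))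
    (hx : ∀ i, ‖x i‖ = 1) :
    1999 / 2000 * (Fintype.card ι : ℝ) ^ 2 ≤ ∑ i, ∑ j, testFun ⟪x i, x j⟫ := by
  have h : ∀ k, 0 ≤ ∑ i, ∑ j, gegenbauer 10 k ⟪x i, x j⟫ := fun k => by
    simpa using sum_gegenbauer_nonneg (σ := Fin 10) (by simp) x hx k
  have h₀ : ∑ i, ∑ j, gegenbauer 10 0 ⟪x i, x j⟫ = (Fintype.card ι : ℝ) ^ 2 := by
    simp [gegenbauer, sq]
  simp only [testFun, Finset.sum_add_distrib, ← Finset.mul_sum, h₀]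
  linarith [h 1, h 2, h 3, h 4, h 5, h 6, h 7, h 11]

lemma row_sum_testFun_le {ι : Type*} [Fintype ι] {x : ι → EuclideanSpace ℝ (Fin 10)}
    (hx : ∀ i, ‖x i‖ = 1) (hsep : ∀ i j, i ≠ j → ⟪x i, x j⟫ ≤ 1 / 2) (i : ι) :
    ∑ j, testFun ⟪x i, x j⟫ ≤ testFun 1 + 91 / 25 := by
  classical
  have hbound : ∀ j, testFun ⟪x i, x j⟫
      ≤ (if i = j then testFun 1 else 0) + 91 / 25 * (2 * antipodalWeight ⟪x i, x j⟫ ^ 2) :=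
    fun j => by
      split_ifs with hij
      · subst hij
        rw [real_inner_self_eq_norm_sq, hx i, one_pow]
        linarith [sq_nonneg (antipodalWeight 1)]
      · have h := abs_real_inner_le_norm (x i) (x j)
        rw [hx i, hx j, mul_one] at h
        rw [zero_add]
        exact testFun_le (abs_le.mp h).1 (hsep i j hij)
  calc ∑ j, testFun ⟪x i, x j⟫
      ≤ ∑ j, ((if i = j then testFun 1 else 0)
          + 91 / 25 * (2 * antipodalWeight ⟪x i, x j⟫ ^ 2)) :=
        Finset.sum_le_sum fun j _ => hbound j
    _ = testFun 1 + 91 / 25 * (2 * ∑ j, antipodalWeight ⟪x i, x j⟫ ^ 2) := by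
        simp [Finset.sum_add_distrib, Finset.mul_sum]
    _ ≤ testFun 1 + 91 / 25 := by
        linarith [sum_sq_antipodalWeight_le (hx i) hx hsep]

end DimensionTen

end KissingBound

/-- The kissing number in dimension 10 is at most 594. -/
theorem kissing_dim10_le (N : ℕ)
    (x : Fin N → EuclideanSpace ℝ (Fin 10))
    (hx : ∀ i, ‖x i‖ = 1)
    (hsep : ∀ i j, i ≠ j → ⟪x i, x j⟫ ≤ 1 / 2) :
    N ≤ 594 := by
  have hlow := KissingBound.sum_testFun_ge x hx
  have hup := Finset.sum_le_sum fun i (_ : i ∈ Finset.univ) =>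
    KissingBound.row_sum_testFun_le hx hsep i
  rw [Finset.sum_const, Finset.card_univ, Fintype.card_fin, nsmul_eq_mul,
    KissingBound.testFun_eq] at hup
  rw [Fintype.card_fin] at hlow
  by_contra! h
  have hN : (595 : ℝ) ≤ N := by exact_mod_cast h
  nlinarith
end

section
/- The kissing number in dimension 9 is at most 379: every finite set of unit vectors x_1, …, x_N in ℝ^{9} satisfying ⟨x_i, x_j⟩ ≤ 1/2 for all i ≠ j has N ≤ 379. -/
open scoped RealInnerProductSpace BigOperators

section Fischer

open MvPolynomial

variable {σ : Type*} [Fintype σ]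

/-- The Fischer inner product on polynomials, in which monomials are orthogonal and the monomial
of exponent `m` has squared norm `m!`. -/
noncomputable def fischer (p q : MvPolynomial σ ℝ) : ℝ :=
  ∑ m ∈ p.support, (∏ i, ((m i).factorial : ℝ)) * coeff m p * coeff m q

theorem fischer_eq_sum (p q : MvPolynomial σ ℝ) {S : Finset (σ →₀ ℕ)} (h : p.support ⊆ S) :
    fischer p q = ∑ m ∈ S, (∏ i, ((m i).factorial : ℝ)) * coeff m p * coeff m q := by
  refine Finset.sum_subset h fun m _ hm => ?_
  rw [notMem_support_iff.mp hm]
  ring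

theorem fischer_self_nonneg (p : MvPolynomial σ ℝ) : 0 ≤ fischer p p := by
  refine Finset.sum_nonneg fun m _ => ?_
  rw [mul_assoc]
  exact mul_nonneg (by positivity) (mul_self_nonneg _)

theorem fischer_add_left (p q r : MvPolynomial σ ℝ) :
    fischer (p + q) r = fischer p r + fischer q r := by
  classical
  rw [fischer_eq_sum (p + q) r support_add,
    fischer_eq_sum p r (Finset.subset_union_left (s₂ := q.support)),
    fischer_eq_sum q r (Finset.subset_union_right (s₁ := p.support)), ← Finset.sum_add_distrib]
  refine Finset.sum_congr rfl fun m _ => ?_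
  rw [coeff_add]
  ring

theorem fischer_zero_left (q : MvPolynomial σ ℝ) : fischer 0 q = 0 := by
  simp [fischer]

theorem fischer_zero_right (p : MvPolynomial σ ℝ) : fischer p 0 = 0 := by
  simp [fischer]

theorem fischer_add_right (p q r : MvPolynomial σ ℝ) :
    fischer p (q + r) = fischer p q + fischer p r := by
  simp only [fischer, coeff_add, mul_add, Finset.sum_add_distrib]

theorem fischer_C_mul_left (a : ℝ) (p q : MvPolynomial σ ℝ) :
    fischer (C a * p) q = a * fischer p q := by
  rw [fischer_eq_sum (C a * p) q (S := p.support), fischer, Finset.mul_sum]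
  · refine Finset.sum_congr rfl fun m _ => ?_
    rw [coeff_C_mul]
    ring
  · rw [C_mul']
    exact support_smul

theorem fischer_sum_left {ι : Type*} (s : Finset ι) (p : ι → MvPolynomial σ ℝ)
    (q : MvPolynomial σ ℝ) : fischer (∑ i ∈ s, p i) q = ∑ i ∈ s, fischer (p i) q := by
  classical
  induction s using Finset.induction_on with
  | empty => simp [fischer_zero_left]
  | insert i s hi ih => rw [Finset.sum_insert hi, Finset.sum_insert hi, fischer_add_left, ih]

theorem fischer_sum_right {ι : Type*} (s : Finset ι) (p : MvPolynomial σ ℝ)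
    (q : ι → MvPolynomial σ ℝ) : fischer p (∑ i ∈ s, q i) = ∑ i ∈ s, fischer p (q i) := by
  classical
  induction s using Finset.induction_on with
  | empty => simp [fischer_zero_right]
  | insert i s hi ih => rw [Finset.sum_insert hi, Finset.sum_insert hi, fischer_add_right, ih]

theorem fischer_monomial (m : σ →₀ ℕ) (a : ℝ) (q : MvPolynomial σ ℝ) :
    fischer (monomial m a) q = (∏ i, ((m i).factorial : ℝ)) * a * coeff m q := by
  classical
  rw [fischer_eq_sum _ q support_monomial_subset, Finset.sum_singleton, coeff_monomial, if_pos rfl]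

/-- Multiplication by a variable is adjoint to the corresponding partial derivative. -/
theorem fischer_X_mul (i : σ) (p q : MvPolynomial σ ℝ) :
    fischer (X i * p) q = fischer p (pderiv i q) := by
  classical
  induction p using MvPolynomial.induction_on' with
  | add p r hp hr => rw [mul_add, fischer_add_left, fischer_add_left, hp, hr]
  | monomial m a =>
    have hX : X i * monomial m a = monomial (m + Finsupp.single i 1) a := by
      rw [mul_comm, monomial_add_single, pow_one]
    have hfact : ∏ j, (((m + Finsupp.single i 1 : σ →₀ ℕ) j).factorial : ℝ) =
        (m i + 1) * ∏ j, ((m j).factorial : ℝ) := by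
      rw [← Finset.mul_prod_erase _ _ (Finset.mem_univ i),
        ← Finset.mul_prod_erase _ (fun j => ((m j).factorial : ℝ)) (Finset.mem_univ i),
        ← mul_assoc]
      congr 1
      · simp [Nat.factorial_succ]
      · refine Finset.prod_congr rfl fun j hj => ?_
        simp [Finsupp.single_eq_of_ne (Finset.ne_of_mem_erase hj)]
    rw [hX, fischer_monomial, fischer_monomial, coeff_pderiv, hfact]
    ring

/-- The linear form `y ↦ ⟨z, y⟩`. -/
noncomputable def linForm (z : σ → ℝ) : MvPolynomial σ ℝ := ∑ i, C (z i) * X i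

/-- The quadratic form `y ↦ ‖y‖²`. -/
noncomputable def normForm (σ : Type*) [Fintype σ] : MvPolynomial σ ℝ := ∑ i, X i ^ 2

/-- The Laplacian on polynomials. -/
noncomputable def polyLaplacian (q : MvPolynomial σ ℝ) : MvPolynomial σ ℝ :=
  ∑ i, pderiv i (pderiv i q)

theorem fischer_normForm_mul (p q : MvPolynomial σ ℝ) :
    fischer (normForm σ * p) q = fischer p (polyLaplacian q) := by
  rw [normForm, polyLaplacian, Finset.sum_mul, fischer_sum_left, fischer_sum_right]
  refine Finset.sum_congr rfl fun i _ => ?_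
  rw [pow_two, mul_assoc, fischer_X_mul, fischer_X_mul]

/-- The powers of linear forms reproduce homogeneous polynomials. -/
theorem fischer_linForm_pow (z : σ → ℝ) (k : ℕ) {q : MvPolynomial σ ℝ} (hq : q.IsHomogeneous k) :
    fischer (linForm z ^ k) q = k.factorial * eval z q := by
  induction k generalizing q with
  | zero =>
    obtain ⟨c, rfl⟩ : ∃ c, q = C c :=
      ⟨_, totalDegree_eq_zero_iff_eq_C.mp ((totalDegree_zero_iff_isHomogeneous _).mpr hq)⟩
    have h1 : (1 : MvPolynomial σ ℝ) = monomial 0 1 := rfl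
    rw [pow_zero, h1, fischer_monomial]
    simp
  | succ k ih =>
    have euler := congrArg (eval z) hq.sum_X_mul_pderiv
    simp only [map_sum, map_mul, eval_X, nsmul_eq_mul, map_natCast] at euler
    rw [pow_succ', linForm, Finset.sum_mul, fischer_sum_left, ← linForm, Nat.factorial_succ]
    simp only [mul_assoc, fischer_C_mul_left, fischer_X_mul]
    push_cast at euler ⊢
    rw [mul_right_comm, ← euler, Finset.sum_mul]
    refine Finset.sum_congr rfl fun i _ => ?_
    rw [ih hq.pderiv]
    ring

theorem isHomogeneous_linForm (z : σ → ℝ) : (linForm z).IsHomogeneous 1 :=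
  IsHomogeneous.sum _ _ _ fun _ _ => isHomogeneous_C_mul_X _ _

theorem isHomogeneous_normForm : (normForm σ).IsHomogeneous 2 :=
  IsHomogeneous.sum _ _ _ fun _ _ => isHomogeneous_X_pow _ _

theorem pderiv_linForm (z : σ → ℝ) (i : σ) : pderiv i (linForm z) = C (z i) := by
  classical
  simp [linForm, pderiv_X, Pi.single_apply]

theorem pderiv_normForm (i : σ) : pderiv i (normForm σ) = 2 * X i := by
  classical
  simp [normForm, pderiv_X, Pi.single_apply]

set_option linter.unusedSimpArgs false in
theorem pderiv_pderiv_linForm_pow_mul_normForm_pow (z : σ → ℝ) (m j : ℕ) (i : σ) :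
    pderiv i (pderiv i (linForm z ^ m * normForm σ ^ j)) =
      C ((m : ℝ) * (m - 1)) * (linForm z ^ (m - 2) * normForm σ ^ j) * C (z i) ^ 2 +
        C (4 * m * j : ℝ) * (linForm z ^ (m - 1) * normForm σ ^ (j - 1)) * (C (z i) * X i) +
        C (2 * j : ℝ) * (linForm z ^ m * normForm σ ^ (j - 1)) +
        C (4 * j * (j - 1) : ℝ) * (linForm z ^ m * normForm σ ^ (j - 2)) * X i ^ 2 := by
  have h2 : pderiv i (2 : MvPolynomial σ ℝ) = 0 := (pderiv i).map_natCast 2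
  have hC2 : (C 2 : MvPolynomial σ ℝ) = 2 := map_ofNat C 2
  have hC4 : (C 4 : MvPolynomial σ ℝ) = 4 := map_ofNat C 4
  rcases m with _ | _ | m <;> rcases j with _ | _ | j <;>
  · simp [pderiv_mul, pderiv_pow, pderiv_linForm, pderiv_normForm, h2, hC2, hC4]
    try ring

theorem polyLaplacian_linForm_pow_mul_normForm_pow (z : σ → ℝ) (hz : ∑ i, z i ^ 2 = 1) (m j : ℕ) :
    polyLaplacian (linForm z ^ m * normForm σ ^ j) =
      C ((m : ℝ) * (m - 1)) * (linForm z ^ (m - 2) * normForm σ ^ j) +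
        C ((j : ℝ) * (2 * (2 * j + Fintype.card σ - 2) + 4 * m)) *
          (linForm z ^ m * normForm σ ^ (j - 1)) := by
  have hz' : ∑ i, (C (z i) : MvPolynomial σ ℝ) ^ 2 = 1 := by
    simp only [← map_pow, ← map_sum, hz, map_one]
  have hC2 : (C 2 : MvPolynomial σ ℝ) = 2 := map_ofNat C 2
  have hC4 : (C 4 : MvPolynomial σ ℝ) = 4 := map_ofNat C 4
  have hL : ∑ i, C (z i) * X i = linForm z := rfl
  have hR : ∑ i, (X i : MvPolynomial σ ℝ) ^ 2 = normForm σ := rfl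
  simp only [polyLaplacian, pderiv_pderiv_linForm_pow_mul_normForm_pow, Finset.sum_add_distrib,
    ← Finset.mul_sum, hz', hL, hR, Finset.sum_const, Finset.card_univ]
  rcases m with _ | m <;> rcases j with _ | _ | j <;>
  · simp [hC2, hC4]
    try ring

/-- The coefficients of the monic Gegenbauer polynomial of degree `k` in dimension `n`: the
coefficient of `t ^ (k - 2 * j)` is `gegenbauerCoeff n k j`. -/
noncomputable def gegenbauerCoeff (n k : ℕ) : ℕ → ℝ
  | 0 => 1
  | j + 1 => -(gegenbauerCoeff n k j * ((k - 2 * j : ℝ) * (k - 2 * j - 1)) /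
      (2 * (j + 1) * (2 * k - 2 * j + n - 4)))

/-- The monic Gegenbauer polynomial of degree `k` in dimension `n`. -/
noncomputable def gegenbauer (n k : ℕ) (t : ℝ) : ℝ :=
  ∑ j ∈ Finset.range (k / 2 + 1), gegenbauerCoeff n k j * t ^ (k - 2 * j)

/-- The zonal harmonic polynomial of degree `k` with pole `z`. -/
noncomputable def zonal (k : ℕ) (z : σ → ℝ) : MvPolynomial σ ℝ :=
  ∑ j ∈ Finset.range (k / 2 + 1),
    C (gegenbauerCoeff (Fintype.card σ) k j) * (linForm z ^ (k - 2 * j) * normForm σ ^ j)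

theorem polyLaplacian_add (p q : MvPolynomial σ ℝ) :
    polyLaplacian (p + q) = polyLaplacian p + polyLaplacian q := by
  simp only [polyLaplacian, map_add, Finset.sum_add_distrib]

theorem polyLaplacian_C_mul (a : ℝ) (p : MvPolynomial σ ℝ) :
    polyLaplacian (C a * p) = C a * polyLaplacian p := by
  simp only [polyLaplacian, pderiv_C_mul, Finset.mul_sum]

theorem polyLaplacian_zonal [Nonempty σ] (k : ℕ) (z : σ → ℝ) (hz : ∑ i, z i ^ 2 = 1) :
    polyLaplacian (zonal k z) = 0 := by
  have hcard : (1 : ℝ) ≤ Fintype.card σ := by exact_mod_cast Fintype.card_pos (α := σ)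
  have partial_sum : ∀ m, 2 * m ≤ k →
      polyLaplacian (∑ j ∈ Finset.range (m + 1), C (gegenbauerCoeff (Fintype.card σ) k j) *
        (linForm z ^ (k - 2 * j) * normForm σ ^ j)) =
      C (gegenbauerCoeff (Fintype.card σ) k m * ((k - 2 * m : ℝ) * (k - 2 * m - 1))) *
        (linForm z ^ (k - 2 * m - 2) * normForm σ ^ m) := by
    intro m
    induction m with
    | zero =>
      intro _
      rw [zero_add, Finset.sum_range_one, polyLaplacian_C_mul,
        polyLaplacian_linForm_pow_mul_normForm_pow z hz]
      simp [mul_assoc]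
    | succ m ih =>
      intro hm
      have hm' : (2 * (m + 1) : ℝ) ≤ k := by exact_mod_cast hm
      have hne : (2 * k - 2 * m + Fintype.card σ - 4 : ℝ) ≠ 0 := by
        have : (0 : ℝ) ≤ m := m.cast_nonneg
        exact ne_of_gt (by linarith)
      have hcoeff : gegenbauerCoeff (Fintype.card σ) k m * ((k - 2 * m : ℝ) * (k - 2 * m - 1)) +
          gegenbauerCoeff (Fintype.card σ) k (m + 1) * (((m + 1 : ℕ) : ℝ) *
            (2 * (2 * ((m + 1 : ℕ) : ℝ) + Fintype.card σ - 2) +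
              4 * (k - ((2 * (m + 1) : ℕ) : ℝ)))) = 0 := by
        have hden : ((m + 1 : ℕ) : ℝ) * (2 * (2 * ((m + 1 : ℕ) : ℝ) + Fintype.card σ - 2) +
            4 * (k - ((2 * (m + 1) : ℕ) : ℝ))) =
              2 * (m + 1) * (2 * k - 2 * m + Fintype.card σ - 4) := by
          push_cast
          ring
        rw [gegenbauerCoeff, hden, neg_mul,
          div_mul_cancel₀ _ (mul_ne_zero (by positivity) hne), add_neg_cancel]
      have hdeg : k - 2 * (m + 1) = k - 2 * m - 2 := by omega
      rw [Finset.sum_range_succ, polyLaplacian_add, ih (by omega), polyLaplacian_C_mul,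
        polyLaplacian_linForm_pow_mul_normForm_pow z hz, Nat.cast_sub hm, Nat.add_sub_cancel, hdeg]
      have hC := congrArg (C (σ := σ)) hcoeff
      push_cast at hC ⊢
      simp only [map_mul, map_add, map_sub, map_natCast, map_ofNat, map_one, map_zero] at hC ⊢
      linear_combination (linForm z ^ (k - 2 * m - 2) * normForm σ ^ m) * hC
  rw [zonal, partial_sum _ (Nat.mul_div_le k 2)]
  have hvanish : ((k : ℝ) - 2 * (k / 2 : ℕ)) * (k - 2 * (k / 2 : ℕ) - 1) = 0 := by
    have hk : (k : ℝ) = 2 * (k / 2 : ℕ) + (k % 2 : ℕ) := by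
      exact_mod_cast (Nat.div_add_mod k 2).symm
    rcases Nat.mod_two_eq_zero_or_one k with h | h <;> rw [h] at hk <;> rw [hk] <;>
      push_cast <;> ring
  rw [hvanish, mul_zero, C_0, zero_mul]

theorem isHomogeneous_zonal (k : ℕ) (z : σ → ℝ) : (zonal k z).IsHomogeneous k := by
  refine IsHomogeneous.sum _ _ _ fun j hj => IsHomogeneous.C_mul ?_ _
  have hdeg : 1 * (k - 2 * j) + 2 * j = k := by
    have := Finset.mem_range.mp hj
    omega
  have h := ((isHomogeneous_linForm z).pow (k - 2 * j)).mul
    ((isHomogeneous_normForm (σ := σ)).pow j)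
  rwa [hdeg] at h

theorem eval_zonal (k : ℕ) (z y : σ → ℝ) (hy : ∑ i, y i ^ 2 = 1) :
    eval y (zonal k z) = gegenbauer (Fintype.card σ) k (∑ i, z i * y i) := by
  simp [zonal, gegenbauer, linForm, normForm, hy]

/-- The reproducing property of zonal harmonics. -/
theorem fischer_zonal [Nonempty σ] (k : ℕ) (z y : σ → ℝ) (hz : ∑ i, z i ^ 2 = 1)
    (hy : ∑ i, y i ^ 2 = 1) :
    fischer (zonal k z) (zonal k y) =
      k.factorial * gegenbauer (Fintype.card σ) k (∑ i, y i * z i) := by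
  conv_lhs => rw [zonal]
  rw [fischer_sum_left, Finset.sum_eq_single_of_mem 0 (by simp)]
  · rw [fischer_C_mul_left, Nat.mul_zero, Nat.sub_zero, pow_zero, mul_one,
      fischer_linForm_pow z k (isHomogeneous_zonal k y), eval_zonal k y z hz, gegenbauerCoeff,
      one_mul]
  · intro j _ hj
    obtain ⟨i, rfl⟩ := Nat.exists_eq_succ_of_ne_zero hj
    rw [fischer_C_mul_left, pow_succ', mul_left_comm, fischer_normForm_mul,
      polyLaplacian_zonal k y hy, fischer_zero_right, mul_zero]

end Fischer

/-- Gegenbauer polynomials are positive definite on the sphere. -/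
theorem sum_gegenbauer_inner_nonneg {ι : Type*} [Fintype ι] {n : ℕ} [NeZero n] (k : ℕ)
    (x : ι → EuclideanSpace ℝ (Fin n)) (hx : ∀ i, ‖x i‖ = 1) :
    0 ≤ ∑ i, ∑ j, gegenbauer n k ⟪x i, x j⟫ := by
  have hsq : ∀ i, ∑ l, x i l ^ 2 = 1 := fun i => by
    rw [← EuclideanSpace.real_norm_sq_eq, hx, one_pow]
  have h := fischer_self_nonneg (∑ i, zonal k (x i))
  simp only [fischer_sum_left, fischer_sum_right, fischer_zonal k _ _ (hsq _) (hsq _),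
    ← Finset.mul_sum, Fintype.card_fin] at h
  have hsum := nonneg_of_mul_nonneg_right h (by positivity)
  rw [Finset.sum_comm]
  simpa only [PiLp.inner_apply, RCLike.inner_apply, conj_trivial] using hsum

/-- Unit vectors at pairwise angle at least `π / 3` and at angle less than `π / 4` from a unit
vector `e` satisfy `∑ (2 ⟪e, y i⟫² - 1) ≤ 1`. -/
theorem sum_two_mul_inner_sq_sub_one_le_one {E ι : Type*} [NormedAddCommGroup E]
    [InnerProductSpace ℝ E] (e : E) (he : ‖e‖ = 1) (s : Finset ι) (y : ι → E)
    (hy : ∀ i ∈ s, ‖y i‖ = 1) (hsep : ∀ i ∈ s, ∀ j ∈ s, i ≠ j → ⟪y i, y j⟫ ≤ 1 / 2)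
    (hpos : ∀ i ∈ s, 0 ≤ ⟪e, y i⟫) (hcap : ∀ i ∈ s, 1 ≤ 2 * ⟪e, y i⟫ ^ 2) :
    ∑ i ∈ s, (2 * ⟪e, y i⟫ ^ 2 - 1) ≤ 1 := by
  classical
  set c : ι → ℝ := fun i => √(2 * ⟪e, y i⟫ ^ 2 - 1) with hc
  set T := ∑ i ∈ s, (2 * ⟪e, y i⟫ ^ 2 - 1) with hT
  have hcc : ∀ i ∈ s, c i * c i = 2 * ⟪e, y i⟫ ^ 2 - 1 := fun i hi =>
    Real.mul_self_sqrt (by linarith [hcap i hi])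
  have hc0 : ∀ i, 0 ≤ c i := fun i => Real.sqrt_nonneg _
  have hTc : T = ∑ i ∈ s, c i * c i := Finset.sum_congr rfl fun i hi => (hcc i hi).symm
  have hT0 : 0 ≤ T := Finset.sum_nonneg fun i hi => by linarith [hcap i hi]
  have hinner : ∀ i j, ⟪y i - ⟪e, y i⟫ • e, y j - ⟪e, y j⟫ • e⟫ =
      ⟪y i, y j⟫ - ⟪e, y i⟫ * ⟪e, y j⟫ := fun i j => by
    simp only [inner_sub_left, inner_sub_right, real_inner_smul_left, real_inner_smul_right,
      real_inner_self_eq_norm_sq, he, real_inner_comm e]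
    ring
  have hterm : ∀ i ∈ s, ∀ j ∈ s,
      c i * c j * ⟪y i - ⟪e, y i⟫ • e, y j - ⟪e, y j⟫ • e⟫ ≤
        (if i = j then c i * c i / 2 else 0) - (c i * c i) * (c j * c j) / 2 := by
    intro i hi j hj
    rw [hinner]
    split_ifs with hij
    · subst hij
      rw [real_inner_self_eq_norm_sq, hy i hi, hcc i hi]
      nlinarith
    · have hsq : (c i * c j + 1) ^ 2 ≤ (2 * (⟪e, y i⟫ * ⟪e, y j⟫)) ^ 2 := by
        have h1 := hcc i hi
        have h2 := hcc j hj
        have h3 : (2 * (⟪e, y i⟫ * ⟪e, y j⟫)) ^ 2 = (c i * c i + 1) * (c j * c j + 1) := by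
          rw [h1, h2]
          ring
        rw [h3]
        nlinarith [sq_nonneg (c i - c j)]
      have hle := abs_le_of_sq_le_sq' hsq
        (by have := mul_nonneg (hpos i hi) (hpos j hj); linarith)
      have := mul_le_mul_of_nonneg_left (a := c i * c j)
        (show ⟪y i, y j⟫ - ⟪e, y i⟫ * ⟪e, y j⟫ ≤ -(c i * c j) / 2 by
          linarith [hsep i hi j hj hij, hle.2]) (mul_nonneg (hc0 i) (hc0 j))
      linarith
  have hnorm : 0 ≤ ⟪∑ i ∈ s, c i • (y i - ⟪e, y i⟫ • e), ∑ i ∈ s, c i • (y i - ⟪e, y i⟫ • e)⟫ :=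
    real_inner_self_nonneg
  have hle : ⟪∑ i ∈ s, c i • (y i - ⟪e, y i⟫ • e), ∑ i ∈ s, c i • (y i - ⟪e, y i⟫ • e)⟫ ≤
      T / 2 - T * T / 2 := by
    simp only [sum_inner, inner_sum, real_inner_smul_left, real_inner_smul_right, ← mul_assoc]
    refine (Finset.sum_le_sum fun i hi => Finset.sum_le_sum fun j hj => ?_).trans_eq
      (b := ∑ i ∈ s, ∑ j ∈ s,
        ((if i = j then c i * c i / 2 else 0) - (c i * c i) * (c j * c j) / 2)) ?_
    · rw [real_inner_comm, mul_comm (c j)]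
      exact hterm i hi j hj
    · simp only [Finset.sum_sub_distrib, ← Finset.sum_div, ← Finset.mul_sum, ← Finset.sum_mul,
        ← hTc, Finset.sum_ite_eq]
      rw [Finset.sum_ite_of_true (fun i hi => hi), ← Finset.sum_div, ← hTc]
  nlinarith

/-- The polynomial used in the linear programming bound. -/
def kissingPoly (t : ℝ) : ℝ :=
  (2 * t + 1) ^ 2 * (16 * t + 5) ^ 2 * (21 * t - 1) ^ 2 * (2 * t - 1) * (7 * t + 5) *
    (62 * t ^ 3 - 73 * t ^ 2 - 48 * t + 91)

/-- The coefficients of `kissingPoly` in the basis of monic Gegenbauer polynomials. -/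
noncomputable def kissingPolyCoeff : ℕ → ℝ
  | 0 => 35348538112 / 21879
  | 1 => 546696268480 / 46189
  | 2 => 198819979424 / 4199
  | 3 => 123789513248 / 969
  | 4 => 82451089563 / 323
  | 5 => 8375449633 / 23
  | 6 => 8476775052 / 23
  | 7 => 21104584096 / 115
  | 8 => 1317216 / 5
  | 9 => 227248 / 3
  | 10 => 222104064
  | 11 => 391974912
  | _ => 0

theorem kissingPolyCoeff_nonneg (k : ℕ) : 0 ≤ kissingPolyCoeff k := by
  unfold kissingPolyCoeff
  split <;> norm_num

theorem kissingPoly_eq_sum_gegenbauer (t : ℝ) :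
    kissingPoly t = ∑ k ∈ Finset.range 12, kissingPolyCoeff k * gegenbauer 9 k t := by
  simp only [Finset.sum_range_succ, Finset.sum_range_zero, kissingPolyCoeff, gegenbauer,
    kissingPoly]
  norm_num [Finset.sum_range_succ, gegenbauerCoeff]
  ring

theorem kissingPoly_nonpos {t : ℝ} (h₁ : -5 / 7 ≤ t) (h₂ : t ≤ 1 / 2) : kissingPoly t ≤ 0 := by
  have hcubic : 0 ≤ 62 * t ^ 3 - 73 * t ^ 2 - 48 * t + 91 := by
    nlinarith [mul_nonneg (sub_nonneg.mpr h₁) (sub_nonneg.mpr h₂),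
      mul_nonneg (sq_nonneg (t - 1 / 2)) (sub_nonneg.mpr h₁)]
  have h : 0 ≤ ((2 * t + 1) * (16 * t + 5) * (21 * t - 1)) ^ 2 * ((1 - 2 * t) * (7 * t + 5)) *
      (62 * t ^ 3 - 73 * t ^ 2 - 48 * t + 91) :=
    mul_nonneg (mul_nonneg (sq_nonneg _) (mul_nonneg (by linarith) (by linarith))) hcubic
  rw [kissingPoly]
  linarith

theorem kissingPoly_le {t : ℝ} (h₁ : -1 ≤ t) (h₂ : t ≤ -5 / 7) :
    kissingPoly t ≤ 4281000 * (2 * t ^ 2 - 1) := by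
  rcases le_total t (-6 / 7) with h | h
  · obtain ⟨p, hp⟩ : ∃ p, p = 7 * t + 7 := ⟨_, rfl⟩
    obtain ⟨q, hq⟩ : ∃ q, q = -7 * t - 6 := ⟨_, rfl⟩
    have hp0 : 0 ≤ p := by linarith
    have hq0 : 0 ≤ q := by linarith
    have hnonneg : 0 ≤
      5685731865733752 * q ^ 11 + 34672239134741656 * p ^ 1 * q ^ 10 +
      86292291056721512 * p ^ 2 * q ^ 9 + 108513587549593408 * p ^ 3 * q ^ 8 +
      68615787468636422 * p ^ 4 * q ^ 7 + 29162712946588907 * p ^ 5 * q ^ 6 +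
      49972609919467256 * p ^ 6 * q ^ 5 + 85786693071844149 * p ^ 7 * q ^ 4 +
      75870191003299014 * p ^ 8 * q ^ 3 + 36712966201171869 * p ^ 9 * q ^ 2 +
      9422297819504220 * p ^ 10 * q ^ 1 + 1010709837447275 * p ^ 11 := by
      positivity
    rw [hp, hq] at hnonneg
    rw [kissingPoly]
    linarith
  · obtain ⟨p, hp⟩ : ∃ p, p = 7 * t + 6 := ⟨_, rfl⟩
    obtain ⟨q, hq⟩ : ∃ q, q = -7 * t - 5 := ⟨_, rfl⟩
    have hp0 : 0 ≤ p := by linarith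
    have hq0 : 0 ≤ q := by linarith
    have hnonneg : 0 ≤
      1010709837447275 * q ^ 11 + 12813318604335830 * p ^ 1 * q ^ 10 +
      70623174049487969 * p ^ 2 * q ^ 9 + 223086578537438028 * p ^ 3 * q ^ 8 +
      449672804985369861 * p ^ 4 * q ^ 7 + 608106551190691630 * p ^ 5 * q ^ 6 +
      562326761191417103 * p ^ 6 * q ^ 5 + 353695446011838336 * p ^ 7 * q ^ 4 +
      146439384558232248 * p ^ 8 * q ^ 3 + 36942853242592920 * p ^ 9 * q ^ 2 +
      4744667148484200 * p ^ 10 * q ^ 1 + 172753791567000 * p ^ 11 := by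
      positivity
    rw [hp, hq] at hnonneg
    rw [kissingPoly]
    linarith

theorem mul_card_sq_le_sum_kissingPoly {ι : Type*} [Fintype ι]
    (x : ι → EuclideanSpace ℝ (Fin 9)) (hx : ∀ i, ‖x i‖ = 1) :
    35348538112 / 21879 * (Fintype.card ι : ℝ) ^ 2 ≤ ∑ i, ∑ j, kissingPoly ⟪x i, x j⟫ := by
  have hsum : ∑ i, ∑ j, kissingPoly ⟪x i, x j⟫ =
      ∑ k ∈ Finset.range 12, kissingPolyCoeff k * ∑ i, ∑ j, gegenbauer 9 k ⟪x i, x j⟫ := by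
    simp only [kissingPoly_eq_sum_gegenbauer, Finset.mul_sum]
    rw [Finset.sum_congr rfl fun i _ => Finset.sum_comm, Finset.sum_comm]
  have hzero : 35348538112 / 21879 * (Fintype.card ι : ℝ) ^ 2 =
      kissingPolyCoeff 0 * ∑ i, ∑ j, gegenbauer 9 0 ⟪x i, x j⟫ := by
    simp [gegenbauer, gegenbauerCoeff, kissingPolyCoeff, pow_two]
  rw [hsum, hzero]
  exact Finset.single_le_sum (f := fun k =>
      kissingPolyCoeff k * ∑ i, ∑ j, gegenbauer 9 k ⟪x i, x j⟫)
    (fun k _ => mul_nonneg (kissingPolyCoeff_nonneg k) (sum_gegenbauer_inner_nonneg k x hx))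
    (Finset.mem_range.mpr (by norm_num))

theorem sum_kissingPoly_inner_le {E ι : Type*} [NormedAddCommGroup E] [InnerProductSpace ℝ E]
    [Fintype ι] (x : ι → E) (hx : ∀ i, ‖x i‖ = 1) (hsep : ∀ i j, i ≠ j → ⟪x i, x j⟫ ≤ 1 / 2)
    (i : ι) : ∑ j, kissingPoly ⟪x i, x j⟫ ≤ kissingPoly 1 + 4281000 := by
  classical
  set S : Finset ι := {j ∈ Finset.univ.erase i | ⟪x i, x j⟫ < -5 / 7} with hS
  have hlt : ∀ j ∈ S, ⟪x i, x j⟫ < -5 / 7 := fun j hj => (Finset.mem_filter.mp hj).2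
  have hcap := sum_two_mul_inner_sq_sub_one_le_one (-x i) (by rw [norm_neg, hx]) S x
    (fun j _ => hx j) (fun j _ l _ => hsep j l)
    (fun j hj => by rw [inner_neg_left]; linarith [hlt j hj])
    (fun j hj => by rw [inner_neg_left]; nlinarith [hlt j hj])
  simp only [inner_neg_left, neg_sq] at hcap
  have hterm : ∀ j ∈ Finset.univ.erase i, kissingPoly ⟪x i, x j⟫ ≤
      if ⟪x i, x j⟫ < -5 / 7 then 4281000 * (2 * ⟪x i, x j⟫ ^ 2 - 1) else 0 := by
    intro j hj
    split_ifs with h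
    · have hge := neg_le_of_abs_le (abs_real_inner_le_norm (x i) (x j))
      rw [hx, hx, one_mul] at hge
      exact kissingPoly_le hge h.le
    · exact kissingPoly_nonpos (not_lt.mp h) (hsep i j (Finset.ne_of_mem_erase hj).symm)
  have hrest := Finset.sum_le_sum hterm
  rw [← Finset.sum_filter, ← Finset.mul_sum, ← hS] at hrest
  rw [← Finset.add_sum_erase _ _ (Finset.mem_univ i), real_inner_self_eq_norm_sq, hx, one_pow]
  linarith

/-- The kissing number in dimension 9 is at most 379. -/
theorem kissing_dim9_le (N : ℕ)
    (x : Fin N → EuclideanSpace ℝ (Fin 9))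
    (hx : ∀ i, ‖x i‖ = 1)
    (hsep : ∀ i j, i ≠ j → ⟪x i, x j⟫ ≤ 1 / 2) :
    N ≤ 379 := by
  by_contra! hN
  have hN' : (380 : ℝ) ≤ N := by exact_mod_cast hN
  have hlower := mul_card_sq_le_sum_kissingPoly x hx
  have hupper := Finset.sum_le_sum fun i (_ : i ∈ Finset.univ) =>
    sum_kissingPoly_inner_le x hx hsep i
  rw [Finset.sum_const, Finset.card_univ, Fintype.card_fin, nsmul_eq_mul] at hupper
  rw [Fintype.card_fin] at hlower
  norm_num [kissingPoly] at hupper hlower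
  nlinarith
end
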